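/- Let Ω ⊆ ℝ³ be open, α : Ω → ℍ(ℂ) a differentiable complex quaternion-valued function and v : Ω → ℂ a scalar function such that Dα + α² = -v on Ω. Then for every twice differentiable scalar function u : Ω → ℂ, the factorization identity (D + M^α)(D - M^α)u = -Δu + vu holds on Ω, i.e., D(Du - uα) + (Du - uα)·α = -Δu + vu. -/

import Mathlib

noncomputable section

/-- Partial derivative `∂ₖ` of a complex-valued function on `ℝ³`. -/
def pd (k : Fin 3) (g : (Fin 3 → ℝ) → ℂ) (x : Fin 3 → ℝ) : ℂ :=
  fderiv ℝ g x (Pi.single k 1)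

/-- Embedding of a vector in `ℂ³` as a pure (vector-part) complex quaternion
`v₁i₁ + v₂i₂ + v₃i₃`. -/
def vecQ (v : Fin 3 → ℂ) : Quaternion ℂ := ⟨0, v 0, v 1, v 2⟩

/-- Componentwise partial derivative of an `ℍ(ℂ)`-valued function. -/
def pdQ (k : Fin 3) (f : (Fin 3 → ℝ) → Quaternion ℂ) (x : Fin 3 → ℝ) : Quaternion ℂ :=
  ⟨pd k (fun y => (f y).re) x, pd k (fun y => (f y).imI) x,
   pd k (fun y => (f y).imJ) x, pd k (fun y => (f y).imK) x⟩

/-- The Moisil–Theodoresco operator `Df = i₁∂₁f + i₂∂₂f + i₃∂₃f`. -/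
def Dq (f : (Fin 3 → ℝ) → Quaternion ℂ) (x : Fin 3 → ℝ) : Quaternion ℂ :=
  vecQ ![1,0,0] * pdQ 0 f x + vecQ ![0,1,0] * pdQ 1 f x + vecQ ![0,0,1] * pdQ 2 f x

/-- Differentiability at a point of an `ℍ(ℂ)`-valued function (componentwise). -/
def QDiffAt (f : (Fin 3 → ℝ) → Quaternion ℂ) (x : Fin 3 → ℝ) : Prop :=
  DifferentiableAt ℝ (fun y => (f y).re) x ∧ DifferentiableAt ℝ (fun y => (f y).imI) x ∧
  DifferentiableAt ℝ (fun y => (f y).imJ) x ∧ DifferentiableAt ℝ (fun y => (f y).imK) x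

/-- Differentiability at a point of a `ℂ³`-valued function (componentwise). -/
def VDiffAt (g : (Fin 3 → ℝ) → Fin 3 → ℂ) (x : Fin 3 → ℝ) : Prop :=
  ∀ k : Fin 3, DifferentiableAt ℝ (fun y => g y k) x

/-- Divergence of a `ℂ³`-valued function. -/
def divg (g : (Fin 3 → ℝ) → Fin 3 → ℂ) (x : Fin 3 → ℝ) : ℂ :=
  ∑ k : Fin 3, pd k (fun y => g y k) x

/-- Gradient of a `ℂ`-valued function. -/
def gradg (h : (Fin 3 → ℝ) → ℂ) (x : Fin 3 → ℝ) : Fin 3 → ℂ := fun k => pd k h x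

/-- Curl (rotor) of a `ℂ³`-valued function. -/
def rotg (g : (Fin 3 → ℝ) → Fin 3 → ℂ) (x : Fin 3 → ℝ) : Fin 3 → ℂ :=
  ![pd 1 (fun y => g y 2) x - pd 2 (fun y => g y 1) x,
    pd 2 (fun y => g y 0) x - pd 0 (fun y => g y 2) x,
    pd 0 (fun y => g y 1) x - pd 1 (fun y => g y 0) x]

/-- Complex-bilinear scalar product on `ℂ³`. -/
def dotC (p q : Fin 3 → ℂ) : ℂ := ∑ k : Fin 3, p k * q k

/-- Cross product on `ℂ³`. -/
def crossC (p q : Fin 3 → ℂ) : Fin 3 → ℂ :=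
  ![p 1 * q 2 - p 2 * q 1, p 2 * q 0 - p 0 * q 2, p 0 * q 1 - p 1 * q 0]

/-- Laplacian of a `ℂ`-valued function. -/
def lap (h : (Fin 3 → ℝ) → ℂ) (x : Fin 3 → ℝ) : ℂ :=
  ∑ k : Fin 3, pd k (fun y => pd k h y) x

theorem pd_zero (k : Fin 3) (x : Fin 3 → ℝ) : pd k (fun _ => 0) x = 0 := by
  simp [pd]

theorem pd_sub {g h : (Fin 3 → ℝ) → ℂ} {x : Fin 3 → ℝ} (k : Fin 3)
    (hg : DifferentiableAt ℝ g x) (hh : DifferentiableAt ℝ h x) :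
    pd k (fun y => g y - h y) x = pd k g x - pd k h x := by
  simp [pd, fderiv_fun_sub hg hh]

theorem pd_mul {g h : (Fin 3 → ℝ) → ℂ} {x : Fin 3 → ℝ} (k : Fin 3)
    (hg : DifferentiableAt ℝ g x) (hh : DifferentiableAt ℝ h x) :
    pd k (fun y => g y * h y) x = g x * pd k h x + pd k g x * h x := by
  simp [pd, fderiv_fun_mul hg hh, mul_comm]

theorem fderiv_eq_sum_pd (u : (Fin 3 → ℝ) → ℂ) (y : Fin 3 → ℝ) :
    fderiv ℝ u y = ∑ k : Fin 3,
      (ContinuousLinearMap.proj (R := ℝ) (φ := fun _ : Fin 3 => ℝ) k).smulRight (pd k u y) := by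
  ext w
  conv_lhs => rw [pi_eq_sum_univ' w]
  simp [pd, map_sum]

/-- Schwarz's theorem: partial derivatives of a twice differentiable function commute. -/
theorem pd_comm {u : (Fin 3 → ℝ) → ℂ} {x : Fin 3 → ℝ}
    (hu : ∀ᶠ y in nhds x, DifferentiableAt ℝ u y)
    (hu' : ∀ k : Fin 3, DifferentiableAt ℝ (fun y => pd k u y) x) (j k : Fin 3) :
    pd j (fun y => pd k u y) x = pd k (fun y => pd j u y) x := by
  have hd : DifferentiableAt ℝ (fderiv ℝ u) x := by
    rw [funext (fderiv_eq_sum_pd u)]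
    exact DifferentiableAt.fun_sum fun k _ =>
      ((ContinuousLinearMap.smulRightL ℝ (Fin 3 → ℝ) ℂ
        (ContinuousLinearMap.proj k)).differentiableAt).comp x (hu' k)
  have hpd (i l : Fin 3) : pd i (fun y => pd l u y) x =
      fderiv ℝ (fderiv ℝ u) x (Pi.single i 1) (Pi.single l 1) := by
    simp only [pd]
    rw [fderiv_clm_apply hd (differentiableAt_const _)]
    simp
  rw [hpd, hpd]
  exact second_derivative_symmetric_of_eventually (hu.mono fun y hy => hy.hasFDerivAt)
    hd.hasFDerivAt _ _

@[simp]
theorem vecQ_re (v : Fin 3 → ℂ) : (vecQ v).re = 0 := rfl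

@[simp]
theorem vecQ_imI (v : Fin 3 → ℂ) : (vecQ v).imI = v 0 := rfl

@[simp]
theorem vecQ_imJ (v : Fin 3 → ℂ) : (vecQ v).imJ = v 1 := rfl

@[simp]
theorem vecQ_imK (v : Fin 3 → ℂ) : (vecQ v).imK = v 2 := rfl

@[simp]
theorem pdQ_re (k : Fin 3) (f : (Fin 3 → ℝ) → Quaternion ℂ) (x : Fin 3 → ℝ) :
    (pdQ k f x).re = pd k (fun y => (f y).re) x := rfl

@[simp]
theorem pdQ_imI (k : Fin 3) (f : (Fin 3 → ℝ) → Quaternion ℂ) (x : Fin 3 → ℝ) :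
    (pdQ k f x).imI = pd k (fun y => (f y).imI) x := rfl

@[simp]
theorem pdQ_imJ (k : Fin 3) (f : (Fin 3 → ℝ) → Quaternion ℂ) (x : Fin 3 → ℝ) :
    (pdQ k f x).imJ = pd k (fun y => (f y).imJ) x := rfl

@[simp]
theorem pdQ_imK (k : Fin 3) (f : (Fin 3 → ℝ) → Quaternion ℂ) (x : Fin 3 → ℝ) :
    (pdQ k f x).imK = pd k (fun y => (f y).imK) x := rfl

theorem Dq_re (f : (Fin 3 → ℝ) → Quaternion ℂ) (x : Fin 3 → ℝ) :
    (Dq f x).re =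
      -pd 0 (fun y => (f y).imI) x - pd 1 (fun y => (f y).imJ) x - pd 2 (fun y => (f y).imK) x := by
  simp [Dq]
  ring

theorem Dq_imI (f : (Fin 3 → ℝ) → Quaternion ℂ) (x : Fin 3 → ℝ) :
    (Dq f x).imI =
      pd 0 (fun y => (f y).re) x + pd 1 (fun y => (f y).imK) x - pd 2 (fun y => (f y).imJ) x := by
  simp [Dq]
  ring

theorem Dq_imJ (f : (Fin 3 → ℝ) → Quaternion ℂ) (x : Fin 3 → ℝ) :
    (Dq f x).imJ =
      pd 1 (fun y => (f y).re) x + pd 2 (fun y => (f y).imI) x - pd 0 (fun y => (f y).imK) x := by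
  simp [Dq]
  ring

theorem Dq_imK (f : (Fin 3 → ℝ) → Quaternion ℂ) (x : Fin 3 → ℝ) :
    (Dq f x).imK =
      pd 2 (fun y => (f y).re) x + pd 0 (fun y => (f y).imJ) x - pd 1 (fun y => (f y).imI) x := by
  simp [Dq]
  ring

/-- On scalar functions the Moisil–Theodoresco operator is the gradient. -/
theorem Dq_coe (u : (Fin 3 → ℝ) → ℂ) (x : Fin 3 → ℝ) :
    Dq (fun y => (u y : Quaternion ℂ)) x = vecQ (gradg u x) := by
  ext <;> simp [Dq_re, Dq_imI, Dq_imJ, Dq_imK, gradg, pd_zero]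

/-- On twice differentiable scalar functions `D² = -Δ`. -/
theorem Dq_gradg {u : (Fin 3 → ℝ) → ℂ} {x : Fin 3 → ℝ}
    (hu : ∀ᶠ y in nhds x, DifferentiableAt ℝ u y)
    (hu' : ∀ k : Fin 3, DifferentiableAt ℝ (fun y => pd k u y) x) :
    Dq (fun y => vecQ (gradg u y)) x = ((-lap u x : ℂ) : Quaternion ℂ) := by
  have h := pd_comm hu hu'
  ext <;> simp [Dq_re, Dq_imI, Dq_imJ, Dq_imK, gradg, pd_zero, lap, Fin.sum_univ_three]
  · ring
  · rw [h 1 2, sub_self]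
  · rw [h 2 0, sub_self]
  · rw [h 0 1, sub_self]

theorem Dq_sub {f g : (Fin 3 → ℝ) → Quaternion ℂ} {x : Fin 3 → ℝ}
    (hf : QDiffAt f x) (hg : QDiffAt g x) :
    Dq (fun y => f y - g y) x = Dq f x - Dq g x := by
  obtain ⟨f0, f1, f2, f3⟩ := hf
  obtain ⟨g0, g1, g2, g3⟩ := hg
  ext <;> simp [Dq_re, Dq_imI, Dq_imJ, Dq_imK, pd_sub, *] <;> ring

/-- Leibniz rule for the product of a scalar function with a quaternion-valued one. -/
theorem Dq_coe_mul {u : (Fin 3 → ℝ) → ℂ} {f : (Fin 3 → ℝ) → Quaternion ℂ} {x : Fin 3 → ℝ}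
    (hu : DifferentiableAt ℝ u x) (hf : QDiffAt f x) :
    Dq (fun y => (u y : Quaternion ℂ) * f y) x =
      vecQ (gradg u x) * f x + (u x : Quaternion ℂ) * Dq f x := by
  obtain ⟨f0, f1, f2, f3⟩ := hf
  ext <;> simp [Dq_re, Dq_imI, Dq_imJ, Dq_imK, gradg, pd_mul, *] <;> ring

theorem QDiffAt.coe_mul {u : (Fin 3 → ℝ) → ℂ} {f : (Fin 3 → ℝ) → Quaternion ℂ}
    {x : Fin 3 → ℝ} (hu : DifferentiableAt ℝ u x) (hf : QDiffAt f x) :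
    QDiffAt (fun y => (u y : Quaternion ℂ) * f y) x := by
  obtain ⟨f0, f1, f2, f3⟩ := hf
  refine ⟨?_, ?_, ?_, ?_⟩ <;> simp <;> fun_prop

/-- Factorization of the Schrödinger operator: if `Dα + α² = -v` on open `Ω`, then for
every twice differentiable scalar `u`, `(D + Mᵅ)(D - Mᵅ)u = -Δu + vu` on `Ω`. -/
theorem schrodinger_factorization
    (Ω : Set (Fin 3 → ℝ)) (hΩ : IsOpen Ω) (α : (Fin 3 → ℝ) → Quaternion ℂ)
    (v : (Fin 3 → ℝ) → ℂ)
    (hα : ∀ x ∈ Ω, QDiffAt α x)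
    (hRic : ∀ x ∈ Ω, Dq α x + α x * α x = ((-(v x) : ℂ) : Quaternion ℂ)) :
    ∀ u : (Fin 3 → ℝ) → ℂ,
      (∀ x ∈ Ω, DifferentiableAt ℝ u x) →
      (∀ k : Fin 3, ∀ x ∈ Ω, DifferentiableAt ℝ (fun y => pd k u y) x) →
      ∀ x ∈ Ω,
        Dq (fun y => Dq (fun z => ((u z : ℂ) : Quaternion ℂ)) y - (u y : Quaternion ℂ) * α y) x
            + (Dq (fun z => ((u z : ℂ) : Quaternion ℂ)) x - (u x : Quaternion ℂ) * α x) * α x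
          = ((-lap u x + v x * u x : ℂ) : Quaternion ℂ) := by
  intro u hu hu' x hx
  have hev : ∀ᶠ y in nhds x, DifferentiableAt ℝ u y :=
    Filter.mem_of_superset (hΩ.mem_nhds hx) hu
  have hgrad : QDiffAt (fun y => vecQ (gradg u y)) x :=
    ⟨differentiableAt_const _, hu' 0 x hx, hu' 1 x hx, hu' 2 x hx⟩
  simp only [Dq_coe]
  rw [Dq_sub hgrad (.coe_mul (hu x hx) (hα x hx)), Dq_gradg hev fun k => hu' k x hx,
    Dq_coe_mul (hu x hx) (hα x hx), eq_sub_of_add_eq (hRic x hx)]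
  simp only [Quaternion.coe_add, Quaternion.coe_neg, Quaternion.coe_mul,
    Quaternion.coe_commutes (v x), mul_sub, mul_neg, sub_mul, mul_assoc]
  abel
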